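/- arXiv:2312.06395 — 2 statements merged into one kernel-verified Lean document; each statement's English description precedes it below -/
import Mathlib

section
/- Let d, K_x, K_z, k, σ, ρ, l be positive real numbers, set b = 0 and u = d. Define η(z) = exp(−z²/(2σ²)) and g(z) = (1 − η(z))·K_x((ρ/l)tanh(kz) − z − (d z − d tanh(z))/(K_z η(z))) − (d z − d tanh(z))/K_z. Then the third derivative of g at 0 equals g′′′(0) = −2d/K_z − (3K_x/σ²)(1 − kρ/l). In particular g′′′(0) < 0 when kρ/l < 1 + 2dσ²/(3K_xK_z) and g′′′(0) > 0 when kρ/l > 1 + 2dσ²/(3K_xK_z), the cases in which the pitchfork bifurcation at (z, u) = (0, d) is respectively supercritical or subcritical with quintic stabilizing term. -/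
theorem Real.hasDerivAt_tanh_one_sub_sq (x : ℝ) :
    HasDerivAt Real.tanh (1 - Real.tanh x ^ 2) x := by
  have hc := (Real.cosh_pos x).ne'
  have h := (Real.hasDerivAt_sinh x).div (Real.hasDerivAt_cosh x) hc
  have e : Real.tanh = Real.sinh / Real.cosh := by
    funext y
    simp [Real.tanh_eq_sinh_div_cosh]
  rw [← e] at h
  refine h.congr_deriv ?_
  rw [Real.tanh_eq_sinh_div_cosh]
  field_simp

theorem Real.contDiff_tanh_real {n : WithTop ℕ∞} : ContDiff ℝ n Real.tanh := by
  have e : Real.tanh = fun y => Real.sinh y / Real.cosh y := by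
    funext y
    exact Real.tanh_eq_sinh_div_cosh y
  rw [e]
  exact Real.contDiff_sinh.div Real.contDiff_cosh fun x => (Real.cosh_pos x).ne'

theorem iteratedDeriv_three_id_sub_tanh_zero :
    iteratedDeriv 3 (fun z : ℝ => z - Real.tanh z) 0 = 2 := by
  have h₁ : deriv (fun z : ℝ => z - Real.tanh z) = fun z => Real.tanh z ^ 2 := by
    funext z
    refine ((hasDerivAt_id z).sub (Real.hasDerivAt_tanh_one_sub_sq z)).deriv.trans ?_
    ring
  have h₂ : deriv (fun z : ℝ => Real.tanh z ^ 2) =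
      fun z => 2 * Real.tanh z * (1 - Real.tanh z ^ 2) := by
    funext z
    refine ((Real.hasDerivAt_tanh_one_sub_sq z).pow 2).deriv.trans ?_
    norm_num
  have h₃ := ((Real.hasDerivAt_tanh_one_sub_sq 0).const_mul 2).mul
    (((Real.hasDerivAt_tanh_one_sub_sq 0).pow 2).const_sub 1)
  rw [iteratedDeriv_succ', h₁, iteratedDeriv_succ', h₂, iteratedDeriv_one]
  refine h₃.deriv.trans ?_
  simp

/-- Third-order Leibniz rule when the first factor vanishes to second order and the second one
vanishes. -/
theorem iteratedDeriv_three_mul_of_eq_zero {f h : ℝ → ℝ} {x : ℝ} (hf : ContDiffAt ℝ 3 f x)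
    (hh : ContDiffAt ℝ 3 h x) (hf₀ : f x = 0) (hf₁ : deriv f x = 0) (hh₀ : h x = 0) :
    iteratedDeriv 3 (f * h) x = 3 * iteratedDeriv 2 f x * deriv h x := by
  rw [iteratedDeriv_mul (n := 3) (by exact_mod_cast hf) (by exact_mod_cast hh)]
  simp [Finset.sum_range_succ, hf₀, hf₁, hh₀]

theorem hasDerivAt_exp_neg_sq_div (c z : ℝ) :
    HasDerivAt (fun z : ℝ => Real.exp (-z ^ 2 / c)) (-2 * z / c * Real.exp (-z ^ 2 / c)) z := by
  have h := (((hasDerivAt_id z).pow 2).neg.div_const c).exp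
  refine h.congr_deriv ?_
  simp
  ring

theorem deriv_one_sub_exp_neg_sq_div (c : ℝ) :
    deriv (fun z : ℝ => 1 - Real.exp (-z ^ 2 / c)) =
      fun z => 2 * z / c * Real.exp (-z ^ 2 / c) := by
  funext z
  refine ((hasDerivAt_exp_neg_sq_div c z).const_sub 1).deriv.trans ?_
  ring

theorem iteratedDeriv_two_one_sub_exp_neg_sq_div_zero (c : ℝ) :
    iteratedDeriv 2 (fun z : ℝ => 1 - Real.exp (-z ^ 2 / c)) 0 = 2 / c := by
  have h := (((hasDerivAt_id (0 : ℝ)).const_mul 2).div_const c).mul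
    (hasDerivAt_exp_neg_sq_div c 0)
  rw [iteratedDeriv_succ', deriv_one_sub_exp_neg_sq_div, iteratedDeriv_one]
  refine h.deriv.trans ?_
  simp

theorem iteratedDeriv_three_bifurcation_function_zero (d Kx Kz k σ r : ℝ) (hKz : Kz ≠ 0) :
    iteratedDeriv 3 (fun z => (1 - Real.exp (-z ^ 2 / (2 * σ ^ 2))) *
        (Kx * (r * Real.tanh (k * z) - z
          - (d * z - d * Real.tanh z) / (Kz * Real.exp (-z ^ 2 / (2 * σ ^ 2)))))
        - (d * z - d * Real.tanh z) / Kz) 0 =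
      3 * (2 / (2 * σ ^ 2)) * (Kx * (r * k - 1)) - d / Kz * 2 := by
  set f : ℝ → ℝ := fun z => 1 - Real.exp (-z ^ 2 / (2 * σ ^ 2)) with hf
  set h : ℝ → ℝ := fun z => Kx * (r * Real.tanh (k * z) - z
    - (d * z - d * Real.tanh z) / (Kz * Real.exp (-z ^ 2 / (2 * σ ^ 2)))) with hh
  set p : ℝ → ℝ := fun z => z - Real.tanh z with hp
  have hη : ContDiff ℝ 3 fun z : ℝ => Real.exp (-z ^ 2 / (2 * σ ^ 2)) :=
    ((contDiff_id.pow 2).neg.div_const _).exp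
  have ht : ContDiff ℝ 3 Real.tanh := Real.contDiff_tanh_real
  have htk : ContDiff ℝ 3 fun z : ℝ => Real.tanh (k * z) :=
    ht.comp (contDiff_const.mul contDiff_id)
  have hfC : ContDiff ℝ 3 f := contDiff_const.sub hη
  have hpC : ContDiff ℝ 3 p := contDiff_id.sub ht
  have hhC : ContDiff ℝ 3 h :=
    contDiff_const.mul (((contDiff_const.mul htk).sub contDiff_id).sub
      (((contDiff_const.mul contDiff_id).sub (contDiff_const.mul ht)).div
        (contDiff_const.mul hη) fun z => mul_ne_zero hKz (Real.exp_pos _).ne'))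
  have hh₁ : deriv h 0 = Kx * (r * k - 1) := by
    have hkz : HasDerivAt (fun z : ℝ => k * z) k 0 := by
      simpa using (hasDerivAt_id (0 : ℝ)).const_mul k
    have htanh := Real.hasDerivAt_tanh_one_sub_sq 0
    have htanhk : HasDerivAt (fun z : ℝ => Real.tanh (k * z))
        ((1 - Real.tanh (k * 0) ^ 2) * k) 0 :=
      (Real.hasDerivAt_tanh_one_sub_sq (k * 0)).comp 0 hkz
    have H := ((((htanhk.const_mul r).sub (hasDerivAt_id (0 : ℝ))).sub
      ((((hasDerivAt_id (0 : ℝ)).const_mul d).sub (htanh.const_mul d)).div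
        ((hasDerivAt_exp_neg_sq_div (2 * σ ^ 2) 0).const_mul Kz)
        (mul_ne_zero hKz (Real.exp_pos _).ne'))).const_mul Kx)
    refine H.deriv.trans ?_
    simp
  have e : (fun z => f z * h z - (d * z - d * Real.tanh z) / Kz) =
      f * h - fun z => d / Kz * p z := by
    funext z
    simp only [Pi.sub_apply, Pi.mul_apply, hp]
    ring
  change iteratedDeriv 3 (fun z => f z * h z - (d * z - d * Real.tanh z) / Kz) 0 = _
  rw [e, iteratedDeriv_sub (n := 3) (by exact_mod_cast (hfC.mul hhC).contDiffAt)
      (by exact_mod_cast (contDiff_const.mul hpC).contDiffAt),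
    iteratedDeriv_three_mul_of_eq_zero hfC.contDiffAt hhC.contDiffAt (by simp [hf])
      (by rw [hf, deriv_one_sub_exp_neg_sq_div]; simp) (by simp [hh]),
    iteratedDeriv_const_mul (n := 3) _ (by exact_mod_cast hpC.contDiffAt), hh₁, hp,
    iteratedDeriv_three_id_sub_tanh_zero, hf, iteratedDeriv_two_one_sub_exp_neg_sq_div_zero]

/-- At the bifurcation point `b = 0`, `u = u* = d`, the third derivative of
the scalar bifurcation function `g` at `0` is
`g′′′(0) = −2d/K_z − (3K_x/σ²)(1 − kρ/l)`; it is negative when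
`kρ/l < 1 + 2dσ²/(3K_xK_z)` (supercritical pitchfork) and positive when
`kρ/l > 1 + 2dσ²/(3K_xK_z)` (subcritical pitchfork with quintic stabilizing term). -/
theorem third_derivative_at_bifurcation
    (d Kx Kz k σ ρ l : ℝ)
    (hd : 0 < d) (hKx : 0 < Kx) (hKz : 0 < Kz) (hk : 0 < k)
    (hσ : 0 < σ) (hρ : 0 < ρ) (hl : 0 < l)
    (η : ℝ → ℝ) (hη : ∀ z, η z = Real.exp (-z^2 / (2*σ^2)))
    (g : ℝ → ℝ)
    (hg : ∀ z, g z = (1 - η z) * (Kx * ((ρ/l) * Real.tanh (k*z) - z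
        - (d*z - d*Real.tanh z)/(Kz * η z)))
        - (d*z - d*Real.tanh z)/Kz) :
    iteratedDeriv 3 g 0 = -2*d/Kz - (3*Kx/σ^2) * (1 - k*ρ/l) ∧
    (k*ρ/l < 1 + 2*d*σ^2/(3*Kx*Kz) → iteratedDeriv 3 g 0 < 0) ∧
    (k*ρ/l > 1 + 2*d*σ^2/(3*Kx*Kz) → 0 < iteratedDeriv 3 g 0) := by
  have key : iteratedDeriv 3 g 0 = -2*d/Kz - (3*Kx/σ^2) * (1 - k*ρ/l) := by
    rw [funext hg, funext hη,
      iteratedDeriv_three_bifurcation_function_zero d Kx Kz k σ (ρ/l) hKz.ne']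
    field_simp
    ring
  have factored : iteratedDeriv 3 g 0 =
      (3*Kx/σ^2) * (k*ρ/l - (1 + 2*d*σ^2/(3*Kx*Kz))) := by
    rw [key]
    field_simp
    ring
  have hpos : 0 < 3*Kx/σ^2 := by positivity
  refine ⟨key, fun h => ?_, fun h => ?_⟩
  · rw [factored]
    exact mul_neg_of_pos_of_neg hpos (sub_neg.mpr h)
  · rw [factored]
    exact mul_pos hpos (sub_pos.mpr h)
end

section
/- Let d, u, b be real numbers with 0 < u < d and b ≠ 0. Then the function F(z) = −d z + u tanh(z) + b is strictly decreasing on ℝ and has exactly one real zero z*, and z* has the same sign as b. (Below the bifurcation point u* = d, the biased nonlinear opinion dynamics ż = −d z + u tanh(z) + b have a unique equilibrium, and the agent's preference agrees with the sign of the bias b.) -/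
theorem Real.hasDerivAt_tanh_inv_cosh_sq (z : ℝ) :
    HasDerivAt Real.tanh (1 / Real.cosh z ^ 2) z := by
  have h := (Real.hasDerivAt_sinh z).div (Real.hasDerivAt_cosh z) (Real.cosh_pos z).ne'
  have hfun : Real.tanh = Real.sinh / Real.cosh := funext Real.tanh_eq_sinh_div_cosh
  rw [hfun]
  rwa [← sq, ← sq, Real.cosh_sq_sub_sinh_sq] at h

theorem Real.abs_tanh_le_one (z : ℝ) : |Real.tanh z| ≤ 1 := by
  rw [Real.tanh_eq_sinh_div_cosh, abs_div, abs_of_pos (Real.cosh_pos z),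
    div_le_one (Real.cosh_pos z)]
  exact abs_le_of_sq_le_sq (by linarith [Real.cosh_sq z]) (Real.cosh_pos z).le

/-- Below the bifurcation point (`0 < u < d`) and with nonzero bias `b`,
the function `F(z) = −d z + u tanh z + b` is strictly decreasing and has exactly one real
zero `z*`, and `z*` has the same sign as `b`. -/
theorem below_bifurcation_unique_equilibrium
    (d u b : ℝ) (hu : 0 < u) (hud : u < d) (hb : b ≠ 0)
    (F : ℝ → ℝ) (hF : ∀ z, F z = -d*z + u*Real.tanh z + b) :
    StrictAnti F ∧
    ∃ zs : ℝ, F zs = 0 ∧ Real.sign zs = Real.sign b ∧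
      ∀ z : ℝ, F z = 0 → z = zs := by
  have hd : 0 < d := hu.trans hud
  have hderiv (z : ℝ) : HasDerivAt F (-d + u * (1 / Real.cosh z ^ 2)) z := by
    rw [funext hF]
    simpa using (((hasDerivAt_id z).const_mul (-d)).add
      ((Real.hasDerivAt_tanh_inv_cosh_sq z).const_mul u)).add_const b
  have hanti : StrictAnti F := by
    refine strictAnti_of_deriv_neg fun z => ?_
    rw [(hderiv z).deriv]
    have h : 1 / Real.cosh z ^ 2 ≤ 1 :=
      div_le_one_of_le₀ (one_le_pow₀ (Real.one_le_cosh z)) (sq_nonneg _)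
    nlinarith
  have hcont : Continuous F := continuous_iff_continuousAt.mpr fun z => (hderiv z).continuousAt
  have hR : 0 ≤ (u + |b|) / d := by positivity
  have hdR : d * ((u + |b|) / d) = u + |b| := mul_div_cancel₀ _ hd.ne'
  have hright : F ((u + |b|) / d) ≤ 0 := by
    have h := (abs_le.mp (Real.abs_tanh_le_one ((u + |b|) / d))).2
    rw [hF]
    nlinarith [le_abs_self b]
  have hleft : 0 ≤ F (-((u + |b|) / d)) := by
    have h := (abs_le.mp (Real.abs_tanh_le_one (-((u + |b|) / d)))).1
    rw [hF]
    nlinarith [neg_abs_le b]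
  obtain ⟨zs, -, hzs⟩ := intermediate_value_Icc' (neg_le_self hR) hcont.continuousOn
    ⟨hright, hleft⟩
  have hzero : F 0 = b := by simp [hF]
  refine ⟨hanti, zs, hzs, ?_, fun z hz => hanti.injective (hz.trans hzs.symm)⟩
  rcases hb.lt_or_gt with hneg | hpos
  · have h : zs < 0 := hanti.lt_iff_gt.mp (by rwa [hzero, hzs])
    rw [Real.sign_of_neg h, Real.sign_of_neg hneg]
  · have h : 0 < zs := hanti.lt_iff_gt.mp (by rwa [hzero, hzs])
    rw [Real.sign_of_pos h, Real.sign_of_pos hpos]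
end
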